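/- arXiv:nlin/0107067 — 3 statements merged into one kernel-verified Lean document; each statement's English description precedes it below -/
import Mathlib

section
/- Fix N ∈ ℕ, real parameters p_1,…,p_N > 0, and a_1,…,a_N, r_1,…,r_N ∈ ℝ. Define η_j(x, y, t, t') = 2 p_j x + 2 p_j³ t' + r_j y + r_j p_j² t and the N-soliton tau function τ_N(x, y, t, t') = Σ_{S ⊆ {1,…,N}} [ Π_{i<j, i,j∈S} ((p_i − p_j)/(p_i + p_j))² ] · Π_{j∈S} a_j exp(η_j(x, y, t, t')). Then τ_N satisfies the Hirota bilinear equation (D_y D_x³ + 2 D_y D_{t'} − 6 D_t D_x) τ_N·τ_N = 0 identically on ℝ⁴. -/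
noncomputable section

/-- Partial derivative in coordinate direction `i` of a function on `Fin 4 → ℝ`. -/
def pd (i : Fin 4) (F : (Fin 4 → ℝ) → ℝ) : (Fin 4 → ℝ) → ℝ :=
  fun q => fderiv ℝ F q (Pi.single i 1)

/-- Iterated partial derivatives along a list of coordinate directions. -/
def pdList : List (Fin 4) → ((Fin 4 → ℝ) → ℝ) → ((Fin 4 → ℝ) → ℝ)
  | [], F => F
  | i :: js, F => pd i (pdList js F)

/-- The Hirota bilinear operator `D` along a list of coordinate directions:
`(D_{i₁} ⋯ D_{iₘ} f·g)(q) = ∂_{s_{i₁}} ⋯ ∂_{s_{iₘ}} [f(q+s) g(q−s)]` at `s = 0`. -/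
def hirotaD (idx : List (Fin 4)) (f g : (Fin 4 → ℝ) → ℝ) (q : Fin 4 → ℝ) : ℝ :=
  pdList idx (fun s => f (q + s) * g (q - s)) 0

/-- The phase `η_j(x,y,t,t') = 2 p_j x + 2 p_j³ t' + r_j y + r_j p_j² t`,
with coordinates `q 0 = x`, `q 1 = y`, `q 2 = t`, `q 3 = t'`. -/
def eta {N : ℕ} (p r : Fin N → ℝ) (j : Fin N) (q : Fin 4 → ℝ) : ℝ :=
  2 * p j * q 0 + 2 * (p j) ^ 3 * q 3 + r j * q 1 + r j * (p j) ^ 2 * q 2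

/-- The `N`-soliton tau function of the (2+1)-dimensional KdV hierarchy. -/
def tauN {N : ℕ} (p a r : Fin N → ℝ) (q : Fin 4 → ℝ) : ℝ :=
  ∑ S : Finset (Fin N),
    (∏ i ∈ S, ∏ j ∈ S.filter (fun j => i < j), ((p i - p j) / (p i + p j)) ^ 2) *
      ∏ j ∈ S, a j * Real.exp (eta p r j q)

/-- The sign `+1` on `W` and `-1` off `W`. -/
def signOn {ι : Type*} [DecidableEq ι] (W : Finset ι) (i : ι) : ℝ := if i ∈ W then 1 else -1

/-- The product of `g i j` over the pairs `i < j` in `s`. -/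
def pairProd {ι : Type*} [LinearOrder ι] (s : Finset ι) (g : ι → ι → ℝ) : ℝ :=
  ∏ i ∈ s, ∏ j ∈ s, if i < j then g i j else 1

/-- The squared Vandermonde product of the signed parameters. -/
def signedVandermonde {ι : Type*} [LinearOrder ι] (p : ι → ℝ) (s W : Finset ι) : ℝ :=
  pairProd s fun i j => (signOn W i * p i - signOn W j * p j) ^ 2

theorem signOn_insert_self {ι : Type*} [DecidableEq ι] (W : Finset ι) (i : ι) :
    signOn (insert i W) i = 1 := by simp [signOn]

theorem signOn_of_notMem {ι : Type*} [DecidableEq ι] {W : Finset ι} {i : ι} (h : i ∉ W) :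
    signOn W i = -1 := by simp [signOn, h]

theorem signOn_insert_of_ne {ι : Type*} [DecidableEq ι] (W : Finset ι) {i j : ι} (h : j ≠ i) :
    signOn (insert i W) j = signOn W j := by simp [signOn, h]

theorem signOn_mul_self {ι : Type*} [DecidableEq ι] (W : Finset ι) (i : ι) :
    signOn W i * signOn W i = 1 := by
  unfold signOn; split_ifs <;> norm_num

theorem pairProd_congr {ι : Type*} [LinearOrder ι] {s : Finset ι} {g h : ι → ι → ℝ}
    (H : ∀ i ∈ s, ∀ j ∈ s, g i j = h i j) : pairProd s g = pairProd s h :=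
  Finset.prod_congr rfl fun i hi => Finset.prod_congr rfl fun j hj => by rw [H i hi j hj]

theorem pairProd_mul {ι : Type*} [LinearOrder ι] (s : Finset ι) (g h : ι → ι → ℝ) :
    pairProd s (fun i j => g i j * h i j) = pairProd s g * pairProd s h := by
  simp only [pairProd, ← Finset.prod_mul_distrib]
  refine Finset.prod_congr rfl fun i _ => Finset.prod_congr rfl fun j _ => ?_
  split_ifs <;> simp

theorem pairProd_insert {ι : Type*} [LinearOrder ι] {s : Finset ι} {m : ι} (hm : m ∉ s)
    {g : ι → ι → ℝ} (hg : ∀ i j, g i j = g j i) :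
    pairProd (insert m s) g = pairProd s g * ∏ j ∈ s, g m j := by
  unfold pairProd
  simp only [Finset.prod_insert hm, lt_irrefl, if_false, one_mul, Finset.prod_mul_distrib]
  rw [mul_left_comm, ← mul_assoc, mul_comm, ← Finset.prod_mul_distrib]
  congr 1
  refine Finset.prod_congr rfl fun j hj => ?_
  have hne : j ≠ m := fun h => hm (h ▸ hj)
  rcases lt_or_gt_of_ne hne with h | h
  · simp [h, h.not_gt, hg j m]
  · simp [h, h.not_gt]

theorem signedVandermonde_insert {ι : Type*} [LinearOrder ι] (p : ι → ℝ) {s : Finset ι} {m : ι}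
    (hm : m ∉ s) (W : Finset ι) :
    signedVandermonde p (insert m s) W =
      signedVandermonde p s W * ∏ j ∈ s, (signOn W m * p m - signOn W j * p j) ^ 2 :=
  pairProd_insert hm fun i j => by ring

theorem signedVandermonde_insert_right {ι : Type*} [LinearOrder ι] (p : ι → ℝ) {s : Finset ι}
    {m : ι} (hm : m ∉ s) (W : Finset ι) :
    signedVandermonde p s (insert m W) = signedVandermonde p s W :=
  pairProd_congr fun i hi j hj => by
    rw [signOn_insert_of_ne W (ne_of_mem_of_not_mem hi hm),
      signOn_insert_of_ne W (ne_of_mem_of_not_mem hj hm)]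

/-- The sum of `σ_j f_j` over `s`, with the signs `σ` given by `W`. -/
def signedSum {ι : Type*} [DecidableEq ι] (s W : Finset ι) (f : ι → ℝ) : ℝ :=
  ∑ j ∈ s, signOn W j * f j

theorem signedSum_insert_right {ι : Type*} [DecidableEq ι] {s : Finset ι} {m : ι} (hm : m ∉ s)
    (W : Finset ι) (f : ι → ℝ) : signedSum s (insert m W) f = signedSum s W f :=
  Finset.sum_congr rfl fun i hi => by
    rw [signOn_insert_of_ne W (ne_of_mem_of_not_mem hi hm)]

theorem signedSum_insert {ι : Type*} [DecidableEq ι] {s : Finset ι} {m : ι} (hm : m ∉ s)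
    (W : Finset ι) (f : ι → ℝ) :
    signedSum (insert m s) W f = signOn W m * f m + signedSum s W f :=
  Finset.sum_insert hm

theorem prod_insert_right {ι : Type*} [DecidableEq ι] (p : ι → ℝ) {s : Finset ι} {m : ι}
    (hm : m ∉ s) (W : Finset ι) (z : ℝ) :
    ∏ j ∈ s, (z - signOn (insert m W) j * p j) ^ 2 = ∏ j ∈ s, (z - signOn W j * p j) ^ 2 :=
  Finset.prod_congr rfl fun i hi => by
    rw [signOn_insert_of_ne W (ne_of_mem_of_not_mem hi hm)]

/-- The contribution of the signs `W` to the soliton condition, as a function of the signed value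
`z` of one further parameter. -/
def solitonTerm {ι : Type*} [LinearOrder ι] (p : ι → ℝ) (s W : Finset ι) (z : ℝ) : ℝ :=
  signedVandermonde p s W *
    ((12 * z ^ 2 * signedSum s W p + 24 * z * signedSum s W p ^ 2 + 8 * signedSum s W p ^ 3 +
      4 * signedSum s W (fun j => p j ^ 3)) * ∏ j ∈ s, (z - signOn W j * p j) ^ 2)

open Polynomial in
theorem exists_polynomial_quadratic_mul_prod {ι : Type*} (s : Finset ι) (u : ι → ℝ) (d c : ℝ) :
    ∃ R : ℝ[X], (∀ k, 2 * s.card < k → Odd k → R.coeff k = 0) ∧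
      ∀ z, R.eval z = d * ((12 * z ^ 2 * (∑ j ∈ s, u j) + 24 * z * (∑ j ∈ s, u j) ^ 2 + c) *
        ∏ j ∈ s, (z - u j) ^ 2) := by
  set e := ∑ j ∈ s, u j with he
  set M : ℝ[X] := (∏ j ∈ s, (X - C (u j))) ^ 2 with hM
  have hP : (∏ j ∈ s, (X - C (u j))).Monic := monic_prod_of_monic _ _ fun j _ => monic_X_sub_C _
  have hMm : M.Monic := hP.pow 2
  have hMd : M.natDegree = 2 * s.card := by
    rw [hM, hP.natDegree_pow, natDegree_prod_of_monic _ _ fun j _ => monic_X_sub_C _]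
    simp
  have hXm : (X + C (2 * e)).Monic := monic_X_add_C _
  have hNd : (M * (X + C (2 * e))).natDegree = 2 * s.card + 1 := by
    rw [hMm.natDegree_mul hXm, hMd, natDegree_X_add_C]
  have hnext : (M * (X + C (2 * e))).nextCoeff = 0 := by
    rw [hMm.nextCoeff_mul hXm, nextCoeff_X_add_C, hM, hP.nextCoeff_pow,
      prod_X_sub_C_nextCoeff]
    simp [he]
  have hcoeff : (M * (X + C (2 * e))).coeff (2 * s.card) = 0 := by
    rw [nextCoeff_of_natDegree_pos (by omega), hNd] at hnext
    simpa using hnext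
  refine ⟨C d * (C (12 * e) * (M * (X + C (2 * e)) * X) + C c * M), ?_, ?_⟩
  · rintro (_ | k) hk hodd
    · omega
    · rw [coeff_C_mul, coeff_add, coeff_C_mul, coeff_C_mul, coeff_mul_X,
        coeff_eq_zero_of_natDegree_lt (p := M) (by omega)]
      have : (M * (X + C (2 * e))).coeff k = 0 := by
        rcases Nat.lt_or_ge (2 * s.card + 1) k with h | h
        · exact coeff_eq_zero_of_natDegree_lt (by omega)
        · have : k = 2 * s.card := by
            obtain ⟨t, ht⟩ := hodd
            omega
          rw [this, hcoeff]
      rw [this]; ring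
  · intro z
    simp only [hM, eval_mul, eval_add, eval_C, eval_X, eval_pow, eval_prod, eval_sub,
      Finset.prod_pow]
    ring

open Polynomial in
/-- An odd polynomial function without odd coefficients beyond `2 n` vanishes if it vanishes at
`n` distinct positive points. -/
theorem eval_sub_eval_neg_eq_zero {ι : Type*} [DecidableEq ι] (s : Finset ι) (p : ι → ℝ)
    (hp : ∀ j ∈ s, 0 < p j)
    (hinj : Set.InjOn p s) (R : ℝ[X]) (hR : ∀ k, 2 * s.card < k → Odd k → R.coeff k = 0)
    (hroot : ∀ j ∈ s, R.eval (p j) - R.eval (-p j) = 0) (z : ℝ) :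
    R.eval z - R.eval (-z) = 0 := by
  set G : ℝ[X] := R - R.comp (-X) with hG
  have heval : ∀ z, G.eval z = R.eval z - R.eval (-z) := fun z => by simp [hG]
  have hdeg : G.natDegree ≤ 2 * s.card := by
    refine natDegree_le_iff_coeff_eq_zero.2 fun k hk => ?_
    have hneg : (-X : ℝ[X]) = C (-1) * X := by simp
    rw [hG, coeff_sub, hneg, comp_C_mul_X_coeff]
    rcases Nat.even_or_odd k with h | h
    · simp [h.neg_one_pow]
    · simp [hR k hk h]
  set A := s.image p with hA
  set B := s.image fun j => -p j with hB
  have hAc : A.card = s.card := Finset.card_image_of_injOn hinj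
  have hBc : B.card = s.card :=
    Finset.card_image_of_injOn fun i hi j hj h => hinj hi hj (neg_injective h)
  have hAp : ∀ x ∈ A, 0 < x := by
    intro x hx
    obtain ⟨j, hj, rfl⟩ := Finset.mem_image.1 hx
    exact hp j hj
  have hBn : ∀ x ∈ B, x < 0 := by
    intro x hx
    obtain ⟨j, hj, rfl⟩ := Finset.mem_image.1 hx
    exact neg_lt_zero.2 (hp j hj)
  have hdisj : Disjoint A B :=
    Finset.disjoint_left.2 fun x h h' => lt_asymm (hAp x h) (hBn x h')
  have h0 : (0 : ℝ) ∉ A ∪ B := by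
    intro h
    rcases Finset.mem_union.1 h with h | h
    · exact lt_irrefl _ (hAp _ h)
    · exact lt_irrefl _ (hBn _ h)
  have hcard : (insert 0 (A ∪ B)).card = 2 * s.card + 1 := by
    rw [Finset.card_insert_of_notMem h0, Finset.card_union_of_disjoint hdisj, hAc, hBc]
    ring
  have hzero : G = 0 := by
    refine eq_zero_of_natDegree_lt_card_of_eval_eq_zero' G (insert 0 (A ∪ B)) ?_ (by omega)
    intro x hx
    rw [heval]
    rcases Finset.mem_insert.1 hx with rfl | hx
    · simp
    rcases Finset.mem_union.1 hx with hx | hx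
    · obtain ⟨j, hj, rfl⟩ := Finset.mem_image.1 hx
      exact hroot j hj
    · obtain ⟨j, hj, rfl⟩ := Finset.mem_image.1 hx
      have := hroot j hj
      rw [neg_neg]; linarith
  rw [← heval, hzero, eval_zero]

theorem sum_solitonTerm_sub_neg_of_mem {ι : Type*} [LinearOrder ι] (p : ι → ℝ) {s : Finset ι}
    {m : ι} (hm : m ∈ s) :
    ∑ W ∈ s.powerset, (solitonTerm p s W (p m) - solitonTerm p s W (-p m)) = 0 := by
  obtain ⟨t, hmt, rfl⟩ : ∃ t, m ∉ t ∧ s = insert m t :=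
    ⟨s.erase m, Finset.notMem_erase _ _, (Finset.insert_erase hm).symm⟩
  rw [Finset.sum_powerset_insert hmt, ← Finset.sum_add_distrib]
  refine Finset.sum_eq_zero fun W hW => ?_
  have hmW : m ∉ W := fun h => hmt (Finset.mem_powerset.1 hW h)
  simp only [solitonTerm, signedVandermonde_insert p hmt, signedVandermonde_insert_right p hmt,
    signedSum_insert hmt, signedSum_insert_right hmt, Finset.prod_insert hmt,
    prod_insert_right p hmt, signOn_insert_self, signOn_of_notMem hmW, one_mul, neg_one_mul]
  ring

theorem sum_solitonTerm_sub_neg_of_injOn {ι : Type*} [LinearOrder ι] (p : ι → ℝ) (s : Finset ι)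
    (hp : ∀ j ∈ s, 0 < p j) (hinj : Set.InjOn p s) (z : ℝ) :
    ∑ W ∈ s.powerset, (solitonTerm p s W z - solitonTerm p s W (-z)) = 0 := by
  choose R hR hRe using fun W : Finset ι =>
    exists_polynomial_quadratic_mul_prod s (fun j => signOn W j * p j) (signedVandermonde p s W)
      (8 * signedSum s W p ^ 3 + 4 * signedSum s W (fun j => p j ^ 3))
  have heval : ∀ W z, (R W).eval z = solitonTerm p s W z := by
    intro W z
    rw [hRe, solitonTerm, signedSum]
    ring
  have key := eval_sub_eval_neg_eq_zero s p hp hinj (∑ W ∈ s.powerset, R W)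
    (fun k hk hodd => by
      rw [Polynomial.finsetSum_coeff]
      exact Finset.sum_eq_zero fun W _ => hR W k hk hodd)
  simp only [Polynomial.eval_finsetSum, heval, ← Finset.sum_sub_distrib] at key
  exact key (fun j hj => sum_solitonTerm_sub_neg_of_mem p hj) z

open Filter Topology in
theorem sum_solitonTerm_sub_neg {N : ℕ} (p : Fin N → ℝ) (hp : ∀ j, 0 < p j)
    (s : Finset (Fin N)) (z : ℝ) :
    ∑ W ∈ s.powerset, (solitonTerm p s W z - solitonTerm p s W (-z)) = 0 := by
  set P : ℝ → Fin N → ℝ := fun ε j => p j + ε * j with hP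
  have hbad : ∀ᶠ ε in 𝓝[>] (0 : ℝ), ∀ i j : Fin N, i ≠ j → P ε i ≠ P ε j := by
    refine eventually_all.2 fun i => eventually_all.2 fun j => eventually_imp_distrib_left.2
      fun hij => ?_
    have hij' : (i : ℝ) - j ≠ 0 := sub_ne_zero.2 fun h => hij (Fin.ext (by exact_mod_cast h))
    have hev : ∀ᶠ ε in 𝓝[>] (0 : ℝ), ε ≠ (p j - p i) / ((i : ℝ) - j) := by
      by_cases h0 : (p j - p i) / ((i : ℝ) - j) = 0
      · rw [h0]
        filter_upwards [self_mem_nhdsWithin] with ε hε using ne_of_gt hε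
      · exact (eventually_ne_nhds (Ne.symm h0)).filter_mono nhdsWithin_le_nhds
    filter_upwards [hev] with ε hε h
    apply hε
    rw [eq_div_iff hij']
    simp only [hP] at h
    linarith
  have hcont : Continuous fun ε =>
      ∑ W ∈ s.powerset, (solitonTerm (P ε) s W z - solitonTerm (P ε) s W (-z)) := by
    have hPc : ∀ j, Continuous fun ε => P ε j := fun j => by simp only [hP]; fun_prop
    have hV : ∀ W, Continuous fun ε => signedVandermonde (P ε) s W := by
      intro W
      unfold signedVandermonde pairProd
      refine continuous_finsetProd _ fun i _ => continuous_finsetProd _ fun j _ => ?_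
      split_ifs <;> fun_prop
    simp only [solitonTerm, signedSum]
    fun_prop
  have hlim := (hcont.tendsto 0).mono_left (nhdsWithin_le_nhds (s := Set.Ioi 0))
  have hzero : (fun ε => ∑ W ∈ s.powerset,
      (solitonTerm (P ε) s W z - solitonTerm (P ε) s W (-z))) =ᶠ[𝓝[>] (0 : ℝ)] fun _ => 0 := by
    filter_upwards [hbad, self_mem_nhdsWithin] with ε hε hpos
    refine sum_solitonTerm_sub_neg_of_injOn _ s (fun j _ => ?_) (fun i _ j _ h => ?_) z
    · have : 0 ≤ ε * (j : ℝ) := mul_nonneg (le_of_lt hpos) (Nat.cast_nonneg _)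
      have := hp j
      simp only [hP]; linarith
    · by_contra hij
      exact hε i j hij h
  have := tendsto_nhds_unique (hlim.congr' hzero) tendsto_const_nhds
  simpa [hP] using this

theorem sum_signOn_mul_signedVandermonde {N : ℕ} (p : Fin N → ℝ) (hp : ∀ j, 0 < p j)
    {V : Finset (Fin N)} {m : Fin N} (hm : m ∈ V) :
    ∑ W ∈ V.powerset, signOn W m * (8 * signedSum V W p ^ 3 +
      4 * signedSum V W (fun j => p j ^ 3) - 12 * p m ^ 2 * signedSum V W p) *
        signedVandermonde p V W = 0 := by
  obtain ⟨t, hmt, rfl⟩ : ∃ t, m ∉ t ∧ V = insert m t :=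
    ⟨V.erase m, Finset.notMem_erase _ _, (Finset.insert_erase hm).symm⟩
  rw [← sum_solitonTerm_sub_neg p hp t (p m), Finset.sum_powerset_insert hmt,
    ← Finset.sum_add_distrib]
  refine Finset.sum_congr rfl fun W hW => ?_
  have hmW : m ∉ W := fun h => hmt (Finset.mem_powerset.1 hW h)
  simp only [solitonTerm, signedVandermonde_insert p hmt, signedVandermonde_insert_right p hmt,
    signedSum_insert hmt, signedSum_insert_right hmt,
    prod_insert_right p hmt, signOn_insert_self, signOn_of_notMem hmW, one_mul, neg_one_mul]
  ring

/-- The symbol of `D_y D_x³ + 2 D_y D_{t'} − 6 D_t D_x` at the wave vector `k`. -/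
def bilinearSymbol (k : Fin 4 → ℝ) : ℝ := k 1 * k 0 ^ 3 + 2 * (k 1 * k 3) - 6 * (k 2 * k 0)

/-- The wave vector of the `j`-th soliton. -/
def waveVector {N : ℕ} (p r : Fin N → ℝ) (j : Fin N) : Fin 4 → ℝ :=
  ![2 * p j, r j, r j * p j ^ 2, 2 * p j ^ 3]

theorem soliton_condition {N : ℕ} (p r : Fin N → ℝ) (hp : ∀ j, 0 < p j) (V : Finset (Fin N)) :
    ∑ W ∈ V.powerset, bilinearSymbol (fun k => signedSum V W fun j => waveVector p r j k) *
      signedVandermonde p V W = 0 := by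
  have hterm : ∀ W ∈ V.powerset,
      bilinearSymbol (fun k => signedSum V W fun j => waveVector p r j k) *
        signedVandermonde p V W = ∑ m ∈ V, r m * (signOn W m * (8 * signedSum V W p ^ 3 +
          4 * signedSum V W (fun j => p j ^ 3) - 12 * p m ^ 2 * signedSum V W p) *
            signedVandermonde p V W) := by
    intro W _
    have h0 : signedSum V W (fun j => 2 * p j) = 2 * signedSum V W p := by
      simp only [signedSum, Finset.mul_sum]
      exact Finset.sum_congr rfl fun _ _ => by ring
    have h3 : signedSum V W (fun j => 2 * p j ^ 3) = 2 * signedSum V W (fun j => p j ^ 3) := by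
      simp only [signedSum, Finset.mul_sum]
      exact Finset.sum_congr rfl fun _ _ => by ring
    simp only [bilinearSymbol, waveVector, Matrix.cons_val]
    rw [h0, h3]
    generalize signedSum V W p = e
    generalize signedSum V W (fun j => p j ^ 3) = c
    generalize signedVandermonde p V W = d
    calc _ = signedSum V W r * ((8 * e ^ 3 + 4 * c) * d) -
          signedSum V W (fun j => r j * p j ^ 2) * (12 * e * d) := by ring
      _ = _ := by
        simp only [signedSum, Finset.sum_mul, ← Finset.sum_sub_distrib]
        exact Finset.sum_congr rfl fun _ _ => by ring
  rw [Finset.sum_congr rfl hterm, Finset.sum_comm]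
  refine Finset.sum_eq_zero fun m hm => ?_
  rw [← Finset.mul_sum, sum_signOn_mul_signedVandermonde p hp hm, mul_zero]

theorem pairProd_eq_univ {ι : Type*} [LinearOrder ι] [Fintype ι] (s : Finset ι)
    (g : ι → ι → ℝ) :
    pairProd s g = pairProd Finset.univ fun i j => if i ∈ s ∧ j ∈ s then g i j else 1 := by
  unfold pairProd
  rw [← Finset.prod_subset (Finset.subset_univ s)]
  · refine Finset.prod_congr rfl fun i hi => ?_
    rw [← Finset.prod_subset (Finset.subset_univ s)]
    · exact Finset.prod_congr rfl fun j hj => by simp [hi, hj]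
    · intro j _ hj
      simp [hj]
  · intro i _ hi
    simp [hi]

theorem pairProd_mul_pairProd {ι : Type*} [LinearOrder ι] [Fintype ι] (S T : Finset ι)
    (g : ι → ι → ℝ) :
    pairProd S g * pairProd T g =
      pairProd (S ∩ T) g ^ 2 *
        (pairProd Finset.univ fun i j =>
          if i ∈ S ∩ T ∧ j ∈ symmDiff S T ∨ i ∈ symmDiff S T ∧ j ∈ S ∩ T then g i j else 1) *
        pairProd (symmDiff S T) fun i j => if i ∈ S \ T ↔ j ∈ S \ T then g i j else 1 := by
  rw [pairProd_eq_univ S, pairProd_eq_univ T, pairProd_eq_univ (S ∩ T),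
    pairProd_eq_univ (symmDiff S T), sq]
  simp only [← pairProd_mul]
  refine pairProd_congr fun i _ j _ => ?_
  by_cases h1 : i ∈ S <;> by_cases h2 : i ∈ T <;> by_cases h3 : j ∈ S <;> by_cases h4 : j ∈ T <;>
    simp [Finset.mem_symmDiff, h1, h2, h3, h4]

theorem prod_mul_prod_eq_inter_symmDiff {ι : Type*} [DecidableEq ι] (S T : Finset ι)
    (E : ι → ℝ) :
    (∏ j ∈ S, E j) * ∏ j ∈ T, E j = (∏ j ∈ S ∩ T, E j) ^ 2 * ∏ j ∈ symmDiff S T, E j := by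
  have hd : Disjoint (S ∩ T) (symmDiff S T) := (disjoint_symmDiff_inf S T).symm
  have hu : (S ∩ T) ∪ symmDiff S T = S ∪ T := by
    ext i; simp only [Finset.mem_union, Finset.mem_inter, Finset.mem_symmDiff]; tauto
  rw [← Finset.prod_union_inter, ← hu, Finset.prod_union hd]
  ring

theorem sum_sub_sum_eq_signedSum {ι : Type*} [DecidableEq ι] (S T : Finset ι) (f : ι → ℝ) :
    ∑ j ∈ S, f j - ∑ j ∈ T, f j = signedSum (symmDiff S T) (S \ T) f := by
  have hd : Disjoint (S \ T) (T \ S) := disjoint_sdiff_sdiff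
  have hu : symmDiff S T = S \ T ∪ T \ S := rfl
  rw [← Finset.sum_sdiff_sub_sum_sdiff, signedSum, hu, Finset.sum_union hd, sub_eq_add_neg,
    ← Finset.sum_neg_distrib]
  congr 1
  · exact Finset.sum_congr rfl fun j hj => by rw [signOn, if_pos hj, one_mul]
  · exact Finset.sum_congr rfl fun j hj => by
      rw [signOn, if_neg (Finset.disjoint_right.1 hd hj), neg_one_mul]

/-- The interaction coefficient of two solitons. -/
def interaction {ι : Type*} (p : ι → ℝ) (i j : ι) : ℝ := ((p i - p j) / (p i + p j)) ^ 2

theorem pairProd_interaction_mul {ι : Type*} [LinearOrder ι] (p : ι → ℝ) (hp : ∀ j, 0 < p j)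
    (V W : Finset ι) :
    (pairProd V fun i j => if i ∈ W ↔ j ∈ W then interaction p i j else 1) *
      (pairProd V fun i j => (p i + p j) ^ 2) = signedVandermonde p V W := by
  rw [← pairProd_mul]
  refine pairProd_congr fun i _ j _ => ?_
  have h : p i + p j ≠ 0 := (add_pos (hp i) (hp j)).ne'
  by_cases hi : i ∈ W <;> by_cases hj : j ∈ W <;>
    simp only [interaction, signOn, hi, hj, if_true, if_false, iff_self, iff_false, iff_true,
      not_true_eq_false, div_pow] <;> field_simp <;> ring

theorem pairProd_sq_add_ne_zero {ι : Type*} [LinearOrder ι] (p : ι → ℝ) (hp : ∀ j, 0 < p j)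
    (V : Finset ι) : (pairProd V fun i j => (p i + p j) ^ 2) ≠ 0 := by
  refine Finset.prod_ne_zero_iff.2 fun i _ => Finset.prod_ne_zero_iff.2 fun j _ => ?_
  have := add_pos (hp i) (hp j)
  split_ifs <;> positivity

theorem sum_pairs_inter_symmDiff {ι : Type*} [DecidableEq ι] [Fintype ι] (U V : Finset ι)
    (hUV : Disjoint U V) (h : Finset ι → ℝ) :
    ∑ x : Finset ι × Finset ι with (x.1 ∩ x.2, symmDiff x.1 x.2) = (U, V), h (x.1 \ x.2) =
      ∑ W ∈ V.powerset, h W := by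
  have hdis : ∀ i, i ∈ U → i ∉ V := fun i hi => Finset.disjoint_left.1 hUV hi
  refine Finset.sum_bij' (fun x _ => x.1 \ x.2) (fun W _ => (U ∪ W, U ∪ (V \ W))) ?_ ?_ ?_ ?_ ?_
  · rintro ⟨S, T⟩ hx
    simp only [Finset.mem_filter, Prod.mk.injEq] at hx
    obtain ⟨-, rfl, rfl⟩ := hx
    exact Finset.mem_powerset.2 Finset.subset_union_left
  · intro W hW
    have hW' : ∀ i, i ∈ W → i ∈ V := fun i hi => Finset.mem_powerset.1 hW hi
    simp only [Finset.mem_filter, Finset.mem_univ, true_and, Prod.mk.injEq, Finset.ext_iff,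
      Finset.mem_inter, Finset.mem_union, Finset.mem_sdiff, Finset.mem_symmDiff]
    constructor <;> intro i <;> have h1 := hdis i <;> have h2 := hW' i <;> tauto
  · rintro ⟨S, T⟩ hx
    simp only [Finset.mem_filter, Prod.mk.injEq] at hx
    obtain ⟨-, rfl, rfl⟩ := hx
    simp only [Prod.mk.injEq, Finset.ext_iff,
      Finset.mem_inter, Finset.mem_union, Finset.mem_sdiff, Finset.mem_symmDiff]
    constructor <;> intro i <;> tauto
  · intro W hW
    have hW' : ∀ i, i ∈ W → i ∈ V := fun i hi => Finset.mem_powerset.1 hW hi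
    simp only [Finset.ext_iff, Finset.mem_union, Finset.mem_sdiff]
    intro i
    have h1 := hdis i
    have h2 := hW' i
    tauto
  · intro x _
    rfl

theorem sum_bilinearSymbol_eq_zero {N : ℕ} (p r E : Fin N → ℝ) (hp : ∀ j, 0 < p j) :
    ∑ x : Finset (Fin N) × Finset (Fin N),
      (pairProd x.1 (interaction p) * ∏ j ∈ x.1, E j) *
        (pairProd x.2 (interaction p) * ∏ j ∈ x.2, E j) *
        bilinearSymbol (fun k => ∑ j ∈ x.1, waveVector p r j k - ∑ j ∈ x.2, waveVector p r j k) =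
      0 := by
  rw [← Finset.sum_fiberwise (g := fun x : Finset (Fin N) × Finset (Fin N) =>
    (x.1 ∩ x.2, symmDiff x.1 x.2))]
  refine Finset.sum_eq_zero fun y _ => ?_
  obtain ⟨U, V⟩ := y
  by_cases hUV : Disjoint U V
  swap
  · rw [Finset.filter_eq_empty_iff.2, Finset.sum_empty]
    rintro ⟨S, T⟩ - h
    simp only [Prod.mk.injEq] at h
    obtain ⟨rfl, rfl⟩ := h
    exact hUV (disjoint_symmDiff_inf S T).symm
  set K : ℝ := pairProd U (interaction p) ^ 2 *
    (pairProd Finset.univ fun i j =>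
      if i ∈ U ∧ j ∈ V ∨ i ∈ V ∧ j ∈ U then interaction p i j else 1) *
    ((∏ j ∈ U, E j) ^ 2 * ∏ j ∈ V, E j) with hK
  set Q : ℝ := pairProd V fun i j => (p i + p j) ^ 2 with hQ
  have hQ0 : Q ≠ 0 := pairProd_sq_add_ne_zero p hp V
  have hsum := sum_pairs_inter_symmDiff U V hUV fun W => K / Q *
    (bilinearSymbol (fun k => signedSum V W fun j => waveVector p r j k) *
      signedVandermonde p V W)
  rw [← Finset.mul_sum V.powerset, soliton_condition p r hp, mul_zero] at hsum
  rw [← hsum]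
  refine Finset.sum_congr rfl fun x hx => ?_
  obtain ⟨S, T⟩ := x
  simp only [Finset.mem_filter, Prod.mk.injEq] at hx
  obtain ⟨-, rfl, rfl⟩ := hx
  simp only [sum_sub_sum_eq_signedSum]
  rw [mul_mul_mul_comm, pairProd_mul_pairProd, prod_mul_prod_eq_inter_symmDiff,
    ← pairProd_interaction_mul p hp, ← hQ, hK]
  field_simp

theorem pd_sum_mul_exp {α : Type*} [Fintype α] (C : α → ℝ) (l : α → Fin 4 → ℝ) (i : Fin 4) :
    pd i (fun s => ∑ x, C x * Real.exp (∑ k, l x k * s k)) =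
      fun s => ∑ x, (C x * l x i) * Real.exp (∑ k, l x k * s k) := by
  funext s
  have h : ∀ x, HasFDerivAt (fun s : Fin 4 → ℝ => C x * Real.exp (∑ k, l x k * s k))
      (C x • (Real.exp (∑ k, l x k * s k) •
        ∑ k, l x k • ContinuousLinearMap.proj (R := ℝ) (φ := fun _ : Fin 4 => ℝ) k)) s :=
    fun x => ((HasFDerivAt.fun_sum fun k _ => (hasFDerivAt_apply k s).const_mul _).exp).const_mul _
  rw [pd, (HasFDerivAt.fun_sum fun x _ => h x).fderiv]
  simp only [_root_.sum_apply, _root_.smul_apply, smul_eq_mul,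
    ContinuousLinearMap.proj_apply, Pi.single_apply, mul_ite, mul_one, mul_zero,
    Finset.sum_ite_eq', Finset.mem_univ, if_true]
  exact Finset.sum_congr rfl fun x _ => by ring

theorem pdList_sum_mul_exp {α : Type*} [Fintype α] (C : α → ℝ) (l : α → Fin 4 → ℝ)
    (idx : List (Fin 4)) :
    pdList idx (fun s => ∑ x, C x * Real.exp (∑ k, l x k * s k)) =
      fun s => ∑ x, (C x * (idx.map (l x)).prod) * Real.exp (∑ k, l x k * s k) := by
  induction idx with
  | nil => simp [pdList]
  | cons i idx ih =>
    rw [pdList, ih, pd_sum_mul_exp]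
    simp only [List.map_cons, List.prod_cons, mul_assoc, mul_comm (l _ i)]

theorem tauN_add {N : ℕ} (p a r : Fin N → ℝ) (q s : Fin 4 → ℝ) :
    tauN p a r (q + s) = ∑ S : Finset (Fin N),
      (pairProd S (interaction p) * ∏ j ∈ S, a j * Real.exp (eta p r j q)) *
        Real.exp (∑ k, (∑ j ∈ S, waveVector p r j k) * s k) := by
  refine Finset.sum_congr rfl fun S _ => ?_
  have he : ∀ j, eta p r j (q + s) = eta p r j q + ∑ k, waveVector p r j k * s k := by
    intro j
    simp only [eta, waveVector, Fin.sum_univ_four, Pi.add_apply, Matrix.cons_val]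
    ring
  have hs : ∑ k, (∑ j ∈ S, waveVector p r j k) * s k =
      ∑ j ∈ S, ∑ k, waveVector p r j k * s k := by
    rw [Finset.sum_comm]
    simp only [Finset.sum_mul]
  simp only [he, Real.exp_add, ← mul_assoc, hs, Real.exp_sum, Finset.prod_mul_distrib, pairProd,
    interaction, Finset.prod_filter]

theorem hirotaD_tauN {N : ℕ} (p a r : Fin N → ℝ) (q : Fin 4 → ℝ) (idx : List (Fin 4)) :
    hirotaD idx (tauN p a r) (tauN p a r) q =
      ∑ x : Finset (Fin N) × Finset (Fin N),
        (pairProd x.1 (interaction p) * ∏ j ∈ x.1, a j * Real.exp (eta p r j q)) *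
          (pairProd x.2 (interaction p) * ∏ j ∈ x.2, a j * Real.exp (eta p r j q)) *
          (idx.map fun k =>
            ∑ j ∈ x.1, waveVector p r j k - ∑ j ∈ x.2, waveVector p r j k).prod := by
  have h : (fun s => tauN p a r (q + s) * tauN p a r (q - s)) = fun s =>
      ∑ x : Finset (Fin N) × Finset (Fin N),
        ((pairProd x.1 (interaction p) * ∏ j ∈ x.1, a j * Real.exp (eta p r j q)) *
          (pairProd x.2 (interaction p) * ∏ j ∈ x.2, a j * Real.exp (eta p r j q))) *
          Real.exp (∑ k,
            (∑ j ∈ x.1, waveVector p r j k - ∑ j ∈ x.2, waveVector p r j k) * s k) := by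
    funext s
    rw [sub_eq_add_neg, tauN_add, tauN_add, Finset.sum_mul_sum, ← Finset.sum_product']
    refine Finset.sum_congr rfl fun x _ => ?_
    rw [mul_mul_mul_comm, ← Real.exp_add, ← Finset.sum_add_distrib]
    congr 3
    funext k
    simp only [Pi.neg_apply]
    ring
  rw [hirotaD, h, pdList_sum_mul_exp]
  simp

/-- the `N`-soliton tau function satisfies the bilinear equation
`(D_y D_x³ + 2 D_y D_{t'} − 6 D_t D_x) τ_N·τ_N = 0`. -/
theorem tauN_satisfies_bilinear_2plus1 (N : ℕ) (p a r : Fin N → ℝ)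
    (hp : ∀ j, 0 < p j) :
    ∀ q : Fin 4 → ℝ,
      hirotaD [1, 0, 0, 0] (tauN p a r) (tauN p a r) q +
        2 * hirotaD [1, 3] (tauN p a r) (tauN p a r) q -
        6 * hirotaD [2, 0] (tauN p a r) (tauN p a r) q = 0 := by
  intro q
  rw [← sum_bilinearSymbol_eq_zero p r (fun j => a j * Real.exp (eta p r j q)) hp]
  simp only [hirotaD_tauN, Finset.mul_sum, ← Finset.sum_add_distrib, ← Finset.sum_sub_distrib]
  refine Finset.sum_congr rfl fun x _ => ?_
  simp only [bilinearSymbol, List.map_cons, List.map_nil, List.prod_cons, List.prod_nil]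
  ring
end
end

section
/- Fix N ∈ ℕ, reals p_1,…,p_N > 0, a_1,…,a_N, r_1,…,r_N ∈ ℝ, and nonzero reals α, β with p_j α ≠ ±1 and p_j β ≠ ±1 for all j. For l, k ∈ ℤ and (y_0, y_2) ∈ ℝ² define the semi-discrete N-soliton tau function τ(l, k; y_0, y_2) = Σ_{S ⊆ {1,…,N}} [ Π_{i<j, i,j∈S} ((p_i − p_j)/(p_i + p_j))² ] · Π_{j∈S} φ_j(l, k; y_0, y_2), where φ_j(l, k; y_0, y_2) = a_j exp(r_j y_0 + r_j p_j² y_2) ((1 + p_j α)/(1 − p_j α))^l ((1 + p_j β)/(1 − p_j β))^k. Then τ satisfies the bilinear difference equation 2α τ(l+1, k) τ(l, k) − (α + β) τ(l, k+1) τ(l+1, k−1) − (α − β) τ(l, k−1) τ(l+1, k+1) = 0 for all l, k ∈ ℤ and all (y_0, y_2) ∈ ℝ², where all tau functions are evaluated at the same (y_0, y_2). -/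
noncomputable section

/-- The one-soliton factor `φ_j(l, k; y₀, y₂)` of the semi-discrete tau function. -/
def phiS {N : ℕ} (p a r : Fin N → ℝ) (α β : ℝ) (j : Fin N) (l k : ℤ) (y0 y2 : ℝ) : ℝ :=
  a j * Real.exp (r j * y0 + r j * (p j) ^ 2 * y2) *
    ((1 + p j * α) / (1 - p j * α)) ^ l * ((1 + p j * β) / (1 - p j * β)) ^ k

/-- The semi-discrete `N`-soliton tau function. -/
def tauS {N : ℕ} (p a r : Fin N → ℝ) (α β : ℝ) (l k : ℤ) (y0 y2 : ℝ) : ℝ :=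
  ∑ S : Finset (Fin N),
    (∏ i ∈ S, ∏ j ∈ S.filter (fun j => i < j), ((p i - p j) / (p i + p j)) ^ 2) *
      ∏ j ∈ S, phiS p a r α β j l k y0 y2

/-- The sum over all sign choices `z = (±q₁, …, ±qₙ)` of `∏ h(zᵢ) ∏_{i<j} (zᵢ - zⱼ)²`. -/
def signSum : (ℝ → ℝ) → List ℝ → ℝ
  | _, [] => 1
  | h, q :: qs => h q * signSum (fun z => h z * (z - q) ^ 2) qs +
      h (-q) * signSum (fun z => h z * (z + q) ^ 2) qs

theorem signSum_mul_even {e : ℝ → ℝ} (he : ∀ z, e (-z) = e z) (h : ℝ → ℝ) (qs : List ℝ) :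
    signSum (fun z => e z * h z) qs = (qs.map e).prod * signSum h qs := by
  induction qs generalizing h with
  | nil => simp [signSum]
  | cons q qs ih =>
    simp only [signSum, mul_assoc, ih, he, List.map_cons, List.prod_cons]
    ring

theorem signSum_comp_neg (h : ℝ → ℝ) (qs : List ℝ) :
    signSum (fun z => h (-z)) qs = signSum h qs := by
  induction qs generalizing h with
  | nil => simp [signSum]
  | cons q qs ih =>
    have h1 := ih (fun z => h z * (z + q) ^ 2)
    have h2 := ih (fun z => h z * (z - q) ^ 2)
    simp only [signSum, neg_neg, ← h1, ← h2]
    rw [add_comm]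
    congr 3 <;> (ext z; ring)

theorem signSum_neg_cons (h : ℝ → ℝ) (q : ℝ) (qs : List ℝ) :
    signSum h (-q :: qs) = signSum h (q :: qs) := by
  simp only [signSum, neg_neg, sub_neg_eq_add, ← sub_eq_add_neg]
  rw [add_comm]

theorem signSum_perm {qs qs' : List ℝ} (hq : qs.Perm qs') (h : ℝ → ℝ) :
    signSum h qs = signSum h qs' := by
  induction hq generalizing h with
  | nil => rfl
  | cons x _ ih => simp only [signSum, ih]
  | swap x y l =>
    have comm (u v : ℝ → ℝ) : (fun z => h z * u z * v z) = fun z => h z * v z * u z := by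
      ext z; ring
    simp only [signSum]
    rw [comm (fun z => (z - y) ^ 2) (fun z => (z - x) ^ 2),
      comm (fun z => (z - y) ^ 2) (fun z => (z + x) ^ 2),
      comm (fun z => (z + y) ^ 2) (fun z => (z - x) ^ 2),
      comm (fun z => (z + y) ^ 2) (fun z => (z + x) ^ 2)]
    ring
  | trans _ _ ih1 ih2 => rw [ih1, ih2]

theorem signSum_cons_cons_self (h : ℝ → ℝ) (q : ℝ) (qs : List ℝ) :
    signSum h (q :: q :: qs) = 8 * q ^ 2 * (h q * h (-q)) *
      ((qs.map fun z => (z ^ 2 - q ^ 2) ^ 2).prod * signSum h qs) := by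
  rw [← signSum_mul_even (e := fun z => (z ^ 2 - q ^ 2) ^ 2) (by intro z; ring)]
  simp only [signSum]
  have h1 : (fun z => h z * (z - q) ^ 2 * (z + q) ^ 2) =
      fun z => (z ^ 2 - q ^ 2) ^ 2 * h z := by ext z; ring
  have h2 : (fun z => h z * (z + q) ^ 2 * (z - q) ^ 2) =
      fun z => (z ^ 2 - q ^ 2) ^ 2 * h z := by ext z; ring
  rw [h1, h2]
  ring

open Polynomial in
theorem exists_polynomial_signSum_mul (h : ℝ → ℝ) (qs : List ℝ) :
    ∃ P : ℝ[X], P.natDegree ≤ 2 * qs.length ∧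
      ∀ x, signSum (fun z => h z * (z - x) ^ 2) qs = P.eval x := by
  induction qs generalizing h with
  | nil => exact ⟨1, by simp, by simp [signSum]⟩
  | cons q qs ih =>
    obtain ⟨P, hP, hPe⟩ := ih fun z => h z * (z - q) ^ 2
    obtain ⟨Q, hQ, hQe⟩ := ih fun z => h z * (z + q) ^ 2
    have hC (c y : ℝ) : (C c * (C y - X) ^ 2 : ℝ[X]).natDegree ≤ 2 := by compute_degree
    refine ⟨C (h q) * (C q - X) ^ 2 * P + C (h (-q)) * (C (-q) - X) ^ 2 * Q, ?_, ?_⟩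
    · rw [List.length_cons, mul_add, mul_one, add_comm (2 * qs.length)]
      exact natDegree_add_le_of_degree_le (natDegree_mul_le_of_le (hC _ _) hP)
        (natDegree_mul_le_of_le (hC _ _) hQ)
    · intro x
      have comm (u v : ℝ → ℝ) : (fun z => h z * u z * v z) = fun z => h z * v z * u z := by
        ext z; ring
      simp only [signSum, eval_add, eval_mul, eval_pow, eval_sub, eval_C, eval_X, ← hPe, ← hQe]
      rw [comm (fun z => (z - x) ^ 2) (fun z => (z - q) ^ 2),
        comm (fun z => (z - x) ^ 2) (fun z => (z + q) ^ 2)]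

open Polynomial in
theorem exists_polynomial_signSum_cons (H : ℝ[X]) {d : ℕ} (hd : H.natDegree ≤ d) (qs : List ℝ) :
    ∃ P : ℝ[X], P.natDegree ≤ d + 2 * qs.length ∧
      ∀ x, signSum (fun z => H.eval z) (x :: qs) = P.eval x := by
  obtain ⟨P, hP, hPe⟩ := exists_polynomial_signSum_mul (fun z => H.eval z) qs
  have hX : (-X : ℝ[X]).natDegree = 1 := by simp
  refine ⟨H * P + H.comp (-X) * P.comp (-X), ?_, ?_⟩
  · refine natDegree_add_le_of_degree_le (natDegree_mul_le_of_le hd hP)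
      (natDegree_mul_le_of_le ?_ ?_) <;> simpa [natDegree_comp]
  · intro x
    have := hPe (-x)
    simp only [sub_neg_eq_add] at this
    simp only [signSum, eval_add, eval_mul, eval_comp, eval_neg, eval_X, ← hPe x, this]

/-- The three-term combination of sign sums whose vanishing encodes the bilinear equation. -/
def signSumComb (α β : ℝ) (qs : List ℝ) : ℝ :=
  2 * α * signSum (fun z => (1 + z * α) * (1 - z ^ 2 * β ^ 2)) qs -
    (α + β) * signSum (fun z => (1 - z * α) * (1 + z * β) ^ 2) qs -
    (α - β) * signSum (fun z => (1 - z * α) * (1 - z * β) ^ 2) qs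

theorem signSumComb_perm {qs qs' : List ℝ} (hq : qs.Perm qs') (α β : ℝ) :
    signSumComb α β qs = signSumComb α β qs' := by
  simp only [signSumComb, signSum_perm hq]

theorem signSumComb_cons_cons_self (α β q : ℝ) (qs : List ℝ) :
    signSumComb α β (q :: q :: qs) =
      8 * q ^ 2 * ((1 - q ^ 2 * α ^ 2) * (1 - q ^ 2 * β ^ 2) ^ 2) *
        (qs.map fun z => (z ^ 2 - q ^ 2) ^ 2).prod * signSumComb α β qs := by
  simp only [signSumComb, signSum_cons_cons_self]
  ring

theorem signSumComb_neg_cons (α β q : ℝ) (qs : List ℝ) :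
    signSumComb α β (-q :: qs) = signSumComb α β (q :: qs) := by
  simp only [signSumComb, signSum_neg_cons]

theorem signSumComb_inv_right_cons {β : ℝ} (hβ : β ≠ 0) (α : ℝ) (qs : List ℝ) :
    signSumComb α β (β⁻¹ :: qs) = 0 := by
  have h : (fun z : ℝ => (1 - z * α) * (1 + z * β) ^ 2 * (z - β⁻¹) ^ 2) =
      fun z => (1 - z * α) * (1 - z * β) ^ 2 * (z + β⁻¹) ^ 2 := by
    ext z; field_simp; ring
  simp only [signSumComb, signSum, h]
  field_simp
  ring

theorem signSumComb_inv_left_cons {α : ℝ} (hα : α ≠ 0) (β : ℝ) (qs : List ℝ) :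
    ∃ c, signSumComb α β (α⁻¹ :: qs) = c * signSumComb α β qs := by
  have he := signSum_mul_even (e := fun z => α⁻¹ ^ 2 * (1 - z ^ 2 * α ^ 2)) (by intro z; ring)
  have h1 : (fun z : ℝ => (1 + z * α) * (1 - z ^ 2 * β ^ 2) * (z - α⁻¹) ^ 2) =
      fun z => (α⁻¹ ^ 2 * (1 - z ^ 2 * α ^ 2)) *
        (fun z => (1 + z * α) * (1 - z ^ 2 * β ^ 2)) (-z) := by
    ext z; field_simp; ring
  have h2 : (fun z : ℝ => (1 - z * α) * (1 + z * β) ^ 2 * (z + α⁻¹) ^ 2) =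
      fun z => (α⁻¹ ^ 2 * (1 - z ^ 2 * α ^ 2)) *
        (fun z => (1 - z * α) * (1 - z * β) ^ 2) (-z) := by
    ext z; field_simp; ring
  have h3 : (fun z : ℝ => (1 - z * α) * (1 - z * β) ^ 2 * (z + α⁻¹) ^ 2) =
      fun z => (α⁻¹ ^ 2 * (1 - z ^ 2 * α ^ 2)) *
        (fun z => (1 - z * α) * (1 + z * β) ^ 2) (-z) := by
    ext z; field_simp; ring
  refine ⟨2 * (1 - α⁻¹ ^ 2 * β ^ 2) * (qs.map fun z => α⁻¹ ^ 2 * (1 - z ^ 2 * α ^ 2)).prod, ?_⟩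
  simp only [signSumComb, signSum]
  rw [h1, h2, h3]
  simp only [he]
  simp only [signSum_comp_neg (fun z => (1 + z * α) * (1 - z ^ 2 * β ^ 2)),
    signSum_comp_neg (fun z => (1 - z * α) * (1 + z * β) ^ 2),
    signSum_comp_neg (fun z => (1 - z * α) * (1 - z * β) ^ 2)]
  field_simp
  ring

open Polynomial in
theorem exists_polynomial_signSumComb_cons (α β : ℝ) (qs : List ℝ) :
    ∃ P : ℝ[X], P.natDegree ≤ 3 + 2 * qs.length ∧
      ∀ x, signSumComb α β (x :: qs) = P.eval x := by
  obtain ⟨P, hP, hPe⟩ := exists_polynomial_signSum_cons (d := 3)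
    ((1 + X * C α) * (1 - X ^ 2 * C (β ^ 2))) (by compute_degree) qs
  obtain ⟨Q, hQ, hQe⟩ := exists_polynomial_signSum_cons (d := 3)
    ((1 - X * C α) * (1 + X * C β) ^ 2) (by compute_degree) qs
  obtain ⟨R, hR, hRe⟩ := exists_polynomial_signSum_cons (d := 3)
    ((1 - X * C α) * (1 - X * C β) ^ 2) (by compute_degree) qs
  refine ⟨C (2 * α) * P - C (α + β) * Q - C (α - β) * R, ?_, fun x => ?_⟩
  · have hPQ := natDegree_sub_le_of_le ((natDegree_C_mul_le (2 * α) P).trans hP)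
      ((natDegree_C_mul_le (α + β) Q).trans hQ)
    rw [max_self] at hPQ
    exact (natDegree_sub_le_of_le hPQ
      ((natDegree_C_mul_le (α - β) R).trans hR)).trans_eq (max_self _)
  · simp only [eval_sub, eval_mul, eval_C, ← hPe, ← hQe, ← hRe]
    simp only [signSumComb, eval_sub, eval_add, eval_mul, eval_pow, eval_one, eval_C, eval_X]

theorem signSumComb_eq_zero {α β : ℝ} (hα : α ≠ 0) (hβ : β ≠ 0) (hαβ : |α| ≠ |β|) :
    ∀ qs : List ℝ, (∀ q ∈ qs, 0 < q ∧ q ≠ |α|⁻¹ ∧ q ≠ |β|⁻¹) → signSumComb α β qs = 0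
  | [], _ => by simp only [signSumComb, signSum]; ring
  | q :: qs, hq => by
    have dup : ∀ l : List ℝ, l.length = qs.length + 1 →
        (∀ x ∈ l, 0 < x ∧ x ≠ |α|⁻¹ ∧ x ≠ |β|⁻¹) → ¬ l.Nodup → signSumComb α β l = 0 := by
      intro l hl hlv hnd
      obtain ⟨a, ha⟩ := List.exists_duplicate_iff_not_nodup.2 hnd
      obtain ⟨l', hl'⟩ := (List.duplicate_iff_sublist.1 ha).exists_perm_append
      have hlt : l'.length < (q :: qs).length := by
        have := hl'.length_eq
        simp only [List.length_append, List.length_cons, List.length_nil] at this ⊢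
        omega
      have ih := signSumComb_eq_zero hα hβ hαβ l' fun x hx => hlv x (hl'.mem_iff.2 (by simp [hx]))
      rw [signSumComb_perm hl']
      simp [signSumComb_cons_cons_self, ih]
    by_cases hnd : (q :: qs).Nodup
    swap
    · exact dup _ (by simp) hq hnd
    have hqs : ∀ x ∈ qs, 0 < x ∧ x ≠ |α|⁻¹ ∧ x ≠ |β|⁻¹ := fun x hx => hq x (by simp [hx])
    have ih := signSumComb_eq_zero hα hβ hαβ qs hqs
    have hroot : ∀ x ∈ |α|⁻¹ :: |β|⁻¹ :: qs, signSumComb α β (x :: qs) = 0 := by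
      intro x hx
      have habs (y : ℝ) : signSumComb α β (|y|⁻¹ :: qs) = signSumComb α β (y⁻¹ :: qs) := by
        rcases abs_choice y with h | h <;> rw [h]
        rw [inv_neg, signSumComb_neg_cons]
      simp only [List.mem_cons] at hx
      rcases hx with rfl | rfl | hx
      · obtain ⟨c, hc⟩ := signSumComb_inv_left_cons hα β qs
        rw [habs, hc, ih, mul_zero]
      · rw [habs, signSumComb_inv_right_cons hβ]
      · refine dup _ (by simp) ?_ (List.not_nodup_cons_of_mem hx)
        simpa [hqs x hx] using hqs
    have hnodup : (|α|⁻¹ :: |β|⁻¹ :: qs).Nodup := by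
      simp only [List.nodup_cons, List.mem_cons, not_or]
      exact ⟨⟨fun h => hαβ (inv_injective h), fun h => (hqs _ h).2.1 rfl⟩,
        fun h => (hqs _ h).2.2 rfl, hnd.of_cons⟩
    have hpos : ∀ x ∈ |α|⁻¹ :: |β|⁻¹ :: qs, 0 < x := by
      intro x hx
      simp only [List.mem_cons] at hx
      rcases hx with rfl | rfl | hx
      · positivity
      · positivity
      · exact (hqs x hx).1
    obtain ⟨P, hP, hPe⟩ := exists_polynomial_signSumComb_cons α β qs
    set s := (|α|⁻¹ :: |β|⁻¹ :: qs).toFinset with hs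
    have hcard : (s ∪ s.image Neg.neg).card = 4 + 2 * qs.length := by
      rw [Finset.card_union_of_disjoint, Finset.card_image_of_injective _ neg_injective, hs,
        List.toFinset_card_of_nodup hnodup]
      · simp only [List.length_cons]; ring
      · rw [Finset.disjoint_left]
        intro x hx hx'
        obtain ⟨y, hy, rfl⟩ := Finset.mem_image.1 hx'
        have h1 := hpos _ (List.mem_toFinset.1 hx)
        have h2 := hpos _ (List.mem_toFinset.1 hy)
        linarith
    have hP0 : P = 0 := by
      refine Polynomial.eq_zero_of_natDegree_lt_card_of_eval_eq_zero' P (s ∪ s.image Neg.neg)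
        (fun x hx => ?_) (by omega)
      rw [← hPe]
      rcases Finset.mem_union.1 hx with hx | hx
      · exact hroot x (List.mem_toFinset.1 hx)
      · obtain ⟨y, hy, rfl⟩ := Finset.mem_image.1 hx
        rw [signSumComb_neg_cons]
        exact hroot y (List.mem_toFinset.1 hy)
    rw [hPe, hP0, Polynomial.eval_zero]
termination_by qs => qs.length
decreasing_by
  · exact hlt
  · simp

/-- The tau function with soliton weights `u`, computed by adding one soliton at a time. -/
def tauList {ι : Type*} (p : ι → ℝ) : (ι → ℝ) → List ι → ℝ
  | _, [] => 1
  | u, j :: js =>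
      tauList p u js + u j * tauList p (fun k => ((p j - p k) / (p j + p k)) ^ 2 * u k) js

theorem prod_pairs_insert {ι : Type*} [LinearOrder ι] {f : ι → ι → ℝ}
    (hf : ∀ i j, f i j = f j i) {q : ι} {S : Finset ι} (hq : q ∉ S) :
    ∏ i ∈ insert q S, ∏ j ∈ (insert q S).filter (fun j => i < j), f i j =
      (∏ j ∈ S, f q j) * ∏ i ∈ S, ∏ j ∈ S.filter (fun j => i < j), f i j := by
  simp only [Finset.prod_filter]
  simp only [Finset.prod_insert hq, lt_irrefl, if_false, one_mul, Finset.prod_mul_distrib]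
  rw [← mul_assoc, ← Finset.prod_mul_distrib]
  congr 1
  refine Finset.prod_congr rfl fun j hj => ?_
  have hne : j ≠ q := fun h => hq (h ▸ hj)
  rcases lt_or_gt_of_ne hne with h | h
  · simp [h, h.not_gt, hf j q]
  · simp [h, h.not_gt]

theorem sum_powerset_eq_tauList {ι : Type*} [LinearOrder ι] (p u : ι → ℝ) {js : List ι}
    (hjs : js.Nodup) :
    ∑ S ∈ js.toFinset.powerset,
      (∏ i ∈ S, ∏ j ∈ S.filter (fun j => i < j), ((p i - p j) / (p i + p j)) ^ 2) *
        ∏ j ∈ S, u j = tauList p u js := by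
  induction js generalizing u with
  | nil => simp [tauList]
  | cons q js ih =>
    have hq : q ∉ js.toFinset := by simpa using (List.nodup_cons.1 hjs).1
    rw [List.toFinset_cons, Finset.sum_powerset_insert hq, tauList, ← ih _ hjs.of_cons,
      ← ih _ hjs.of_cons, Finset.mul_sum]
    congr 1
    refine Finset.sum_congr rfl fun S hS => ?_
    have hqS : q ∉ S := fun h => hq (Finset.mem_powerset.1 hS h)
    rw [prod_pairs_insert (f := fun i j => ((p i - p j) / (p i + p j)) ^ 2) _ hqS,
      Finset.prod_insert hqS, Finset.prod_mul_distrib]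
    · ring
    · intro i j
      rw [← neg_sub (p j), add_comm (p i), neg_div, neg_sq]

theorem tauS_eq_tauList {N : ℕ} (p a r : Fin N → ℝ) (α β : ℝ) (l k : ℤ) (y0 y2 : ℝ) :
    tauS p a r α β l k y0 y2 =
      tauList p (fun j => phiS p a r α β j l k y0 y2) (List.finRange N) := by
  rw [← sum_powerset_eq_tauList p _ (List.nodup_finRange N), List.toFinset_finRange,
    Finset.powerset_univ]
  rfl

/-- A bilinear relation between tau functions holds as soon as all the associated sign sums
vanish. -/
theorem sum_tauList_mul_tauList_eq_zero {ι κ : Type} [Fintype κ] (p : ι → ℝ)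
    (hp : ∀ j, 0 < p j) (b : κ → ℝ) (h : κ → ℝ → ℝ) (E : ℝ → ℝ)
    (hE : ∀ i z, h i z * h i (-z) = E z)
    (hb : ∀ qs : List ι, ∑ i, b i * signSum (h i) (qs.map p) = 0) (c : ι → ℝ) (js : List ι) :
    ∑ i, b i * (tauList p (fun j => c j * h i (p j)) js *
      tauList p (fun j => c j * h i (-p j)) js) = 0 := by
  induction js generalizing κ b h E c with
  | nil => simpa [tauList, signSum] using hb []
  | cons q js ih =>
    have none := ih b h E hE hb c
    have both := ih b h E hE hb fun k => ((p q - p k) / (p q + p k)) ^ 2 * c k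
    have one := ih (κ := κ ⊕ κ)
      (Sum.elim (fun i => b i * h i (p q)) fun i => b i * h i (-p q))
      (Sum.elim (fun i z => h i z * (z - p q) ^ 2) fun i z => h i z * (z + p q) ^ 2)
      (fun z => E z * (z ^ 2 - p q ^ 2) ^ 2)
      (by rintro (i | i) z <;> simp only [Sum.elim_inl, Sum.elim_inr, ← hE i z] <;> ring)
      (by
        intro qs
        rw [← hb (q :: qs)]
        simp only [Fintype.sum_sum_type, Sum.elim_inl, Sum.elim_inr, List.map_cons, signSum,
          ← Finset.sum_add_distrib]
        refine Finset.sum_congr rfl fun i _ => ?_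
        ring)
      (fun k => c k / (p q + p k) ^ 2)
    have hne (k : ι) : p q + p k ≠ 0 := (add_pos (hp q) (hp k)).ne'
    have e1 (w : ι → ℝ) : (fun k => c k / (p q + p k) ^ 2 * (w k * (p k - p q) ^ 2)) =
        fun k => ((p q - p k) / (p q + p k)) ^ 2 * (c k * w k) := by
      ext k; have := hne k; field_simp; ring
    have e2 (w : ι → ℝ) : (fun k => c k / (p q + p k) ^ 2 * (w k * (p k + p q) ^ 2)) =
        fun k => c k * w k := by
      ext k; have := hne k; field_simp; ring
    have e3 (w : ι → ℝ) : (fun k => c k / (p q + p k) ^ 2 * (w k * (-p k - p q) ^ 2)) =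
        fun k => c k * w k := by
      rw [← e2]; ext k; ring
    have e4 (w : ι → ℝ) : (fun k => c k / (p q + p k) ^ 2 * (w k * (-p k + p q) ^ 2)) =
        fun k => ((p q - p k) / (p q + p k)) ^ 2 * (c k * w k) := by
      rw [← e1]; ext k; ring
    simp only [Fintype.sum_sum_type, Sum.elim_inl, Sum.elim_inr] at one
    simp only [e1 (fun k => h _ (p k)), e2 (fun k => h _ (p k)), e3 (fun k => h _ (-p k)),
      e4 (fun k => h _ (-p k))] at one
    simp only [mul_assoc] at both
    have key := congrArg₂ (· + ·) none
      (congrArg₂ (· + ·) (congrArg (c q * ·) one) (congrArg (c q ^ 2 * E (p q) * ·) both))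
    simp only [mul_zero, add_zero, ← Finset.sum_add_distrib, Finset.mul_sum] at key
    rw [← key]
    refine Finset.sum_congr rfl fun i _ => ?_
    simp only [tauList, ← hE i (p q)]
    ring

/-- the semi-discrete `N`-soliton tau function satisfies the bilinear
difference equation
`2α τ(l+1,k) τ(l,k) − (α+β) τ(l,k+1) τ(l+1,k−1) − (α−β) τ(l,k−1) τ(l+1,k+1) = 0`. -/
theorem tauS_satisfies_bilinear_difference (N : ℕ) (p a r : Fin N → ℝ) (α β : ℝ)
    (hp : ∀ j, 0 < p j) (hα : α ≠ 0) (hβ : β ≠ 0)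
    (hpα : ∀ j, p j * α ≠ 1 ∧ p j * α ≠ -1)
    (hpβ : ∀ j, p j * β ≠ 1 ∧ p j * β ≠ -1) :
    ∀ (l k : ℤ) (y0 y2 : ℝ),
      2 * α * tauS p a r α β (l + 1) k y0 y2 * tauS p a r α β l k y0 y2 -
        (α + β) * tauS p a r α β l (k + 1) y0 y2 * tauS p a r α β (l + 1) (k - 1) y0 y2 -
        (α - β) * tauS p a r α β l (k - 1) y0 y2 * tauS p a r α β (l + 1) (k + 1) y0 y2
        = 0 := by
  intro l k y0 y2
  simp only [tauS_eq_tauList]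
  have hα1 (j) : 1 - p j * α ≠ 0 := fun h => (hpα j).1 (by linarith)
  have hα2 (j) : 1 + p j * α ≠ 0 := fun h => (hpα j).2 (by linarith)
  have hβ1 (j) : 1 - p j * β ≠ 0 := fun h => (hpβ j).1 (by linarith)
  have hβ2 (j) : 1 + p j * β ≠ 0 := fun h => (hpβ j).2 (by linarith)
  have hfac (j) : 1 - p j ^ 2 * β ^ 2 = (1 - p j * β) * (1 + p j * β) := by ring
  have hβ3 (j) : 1 - p j ^ 2 * β ^ 2 ≠ 0 := hfac j ▸ mul_ne_zero (hβ1 j) (hβ2 j)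
  have hA (j) : (1 + p j * α) / (1 - p j * α) ≠ 0 := div_ne_zero (hα2 j) (hα1 j)
  have hB (j) : (1 + p j * β) / (1 - p j * β) ≠ 0 := div_ne_zero (hβ2 j) (hβ1 j)
  have hl (j) (k : ℤ) : phiS p a r α β j (l + 1) k y0 y2 =
      phiS p a r α β j l k y0 y2 * ((1 + p j * α) / (1 - p j * α)) := by
    simp only [phiS, zpow_add_one₀ (hA j)]; ring
  have hk (j) : phiS p a r α β j l (k + 1) y0 y2 =
      phiS p a r α β j l k y0 y2 * ((1 + p j * β) / (1 - p j * β)) := by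
    simp only [phiS, zpow_add_one₀ (hB j)]; ring
  have hk' (j) : phiS p a r α β j l (k - 1) y0 y2 =
      phiS p a r α β j l k y0 y2 * ((1 - p j * β) / (1 + p j * β)) := by
    simp only [phiS, zpow_sub_one₀ (hB j), inv_div]; ring
  simp only [hl, hk, hk']
  by_cases hαβ : |α| = |β|
  · rcases abs_eq_abs.1 hαβ with rfl | rfl
    · have e (j) (x : ℝ) : x * ((1 - p j * α) / (1 + p j * α)) *
          ((1 + p j * α) / (1 - p j * α)) = x := by
        have := hα1 j; have := hα2 j; field_simp
      simp only [e]
      ring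
    · have e (j) (x : ℝ) : x * ((1 + p j * β) / (1 - p j * β)) *
          ((1 + p j * -β) / (1 - p j * -β)) = x := by
        have := hβ1 j; have := hβ2 j
        simp only [mul_neg, sub_neg_eq_add, ← sub_eq_add_neg]
        field_simp
      simp only [e]
      simp only [mul_neg, sub_neg_eq_add, ← sub_eq_add_neg]
      ring
  · have hval (y : ℝ) (hy : ∀ j, p j * y ≠ 1 ∧ p j * y ≠ -1) (j) : p j ≠ |y|⁻¹ := by
      intro h
      have hy0 : y ≠ 0 := by
        rintro rfl
        exact (hp j).ne' (by simpa using h)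
      have h1 : |p j * y| = 1 := by
        rw [abs_mul, abs_of_pos (hp j), h, inv_mul_cancel₀ (abs_ne_zero.2 hy0)]
      rcases eq_or_eq_neg_of_abs_eq h1 with h | h
      · exact (hy j).1 h
      · exact (hy j).2 h
    have main := sum_tauList_mul_tauList_eq_zero p hp ![2 * α, -(α + β), -(α - β)]
      ![fun z => (1 + z * α) * (1 - z ^ 2 * β ^ 2), fun z => (1 - z * α) * (1 + z * β) ^ 2,
        fun z => (1 - z * α) * (1 - z * β) ^ 2]
      (fun z => (1 - z ^ 2 * α ^ 2) * (1 - z ^ 2 * β ^ 2) ^ 2)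
      (by intro i z; fin_cases i <;> simp <;> ring)
      (by
        intro qs
        have h0 := signSumComb_eq_zero hα hβ hαβ (qs.map p) (by
          intro x hx
          obtain ⟨j, -, rfl⟩ := List.mem_map.1 hx
          exact ⟨hp j, hval α hpα j, hval β hpβ j⟩)
        rw [← h0]
        simp [Fin.sum_univ_three, signSumComb]
        ring)
      (fun j => phiS p a r α β j l k y0 y2 / ((1 - p j * α) * (1 - p j ^ 2 * β ^ 2)))
      (List.finRange N)
    have e1 (j) (x : ℝ) : x / ((1 - p j * α) * (1 - p j ^ 2 * β ^ 2)) *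
        ((1 + p j * α) * (1 - p j ^ 2 * β ^ 2)) =
          x * ((1 + p j * α) / (1 - p j * α)) := by
      have := hα1 j; have := hβ3 j; field_simp
    have e2 (j) (x : ℝ) : x / ((1 - p j * α) * (1 - p j ^ 2 * β ^ 2)) *
        ((1 + -p j * α) * (1 - (-p j) ^ 2 * β ^ 2)) = x := by
      have := hα1 j; have := hβ3 j
      rw [neg_sq, neg_mul, ← sub_eq_add_neg]
      field_simp
    have e3 (j) (x : ℝ) : x / ((1 - p j * α) * (1 - p j ^ 2 * β ^ 2)) *
        ((1 - p j * α) * (1 + p j * β) ^ 2) =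
          x * ((1 + p j * β) / (1 - p j * β)) := by
      have := hα1 j; have := hβ1 j; have := hβ2 j
      rw [hfac]; field_simp
    have e4 (j) (x : ℝ) : x / ((1 - p j * α) * (1 - p j ^ 2 * β ^ 2)) *
        ((1 - -p j * α) * (1 + -p j * β) ^ 2) =
          x * ((1 - p j * β) / (1 + p j * β)) * ((1 + p j * α) / (1 - p j * α)) := by
      have := hα1 j; have := hβ1 j; have := hβ2 j
      rw [hfac, neg_mul, neg_mul, sub_neg_eq_add, ← sub_eq_add_neg]; field_simp
    have e5 (j) (x : ℝ) : x / ((1 - p j * α) * (1 - p j ^ 2 * β ^ 2)) *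
        ((1 - p j * α) * (1 - p j * β) ^ 2) =
          x * ((1 - p j * β) / (1 + p j * β)) := by
      have := hα1 j; have := hβ1 j; have := hβ2 j
      rw [hfac]; field_simp
    have e6 (j) (x : ℝ) : x / ((1 - p j * α) * (1 - p j ^ 2 * β ^ 2)) *
        ((1 - -p j * α) * (1 - -p j * β) ^ 2) =
          x * ((1 + p j * β) / (1 - p j * β)) * ((1 + p j * α) / (1 - p j * α)) := by
      have := hα1 j; have := hβ1 j; have := hβ2 j
      rw [hfac, neg_mul, neg_mul, sub_neg_eq_add, sub_neg_eq_add]; field_simp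
    simp only [Fin.sum_univ_three, Matrix.cons_val, e1, e2, e3, e4, e5, e6] at main
    linear_combination main
end
end

section
/- Let A = ℂ[s, s⁻¹, t, t⁻¹] be the commutative ring of complex Laurent polynomials in two variables, let Ω_A be the module of Kähler differentials of A over ℂ with universal derivation d : A → Ω_A, and let K = Ω_A / dA be the quotient of Ω_A by the ℂ-submodule dA (the image of d), with canonical projection π : Ω_A → K. Let κ denote the Killing form of the complex Lie algebra sl₂(ℂ). Then the ℂ-bilinear bracket on the vector space g = (sl₂(ℂ) ⊗_ℂ A) ⊕ K determined by [x ⊗ a, y ⊗ b] = [x, y] ⊗ ab + κ(x, y) · π((da) b) for x, y ∈ sl₂(ℂ), a, b ∈ A, and [g, K] = [K, g] = 0, is well defined, alternating ([ξ, ξ] = 0 for all ξ ∈ g), and satisfies the Jacobi identity; hence it makes g into a complex Lie algebra (the 2-toroidal Lie algebra sl₂^tor), in which K is central. -/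
open scoped TensorProduct

noncomputable section

/-- `A = ℂ[s, s⁻¹, t, t⁻¹]`, the ring of complex Laurent polynomials in two variables,
realized as the group algebra of `ℤ × ℤ` over `ℂ`. -/
abbrev LaurentTwo : Type := AddMonoidAlgebra ℂ (ℤ × ℤ)

/-- The Lie algebra `sl₂(ℂ)` of traceless 2×2 complex matrices. -/
abbrev sl2C : Type := LieAlgebra.SpecialLinear.sl (Fin 2) ℂ

/-- The module of Kähler differentials `Ω_A` of `A` over `ℂ`. -/
abbrev OmegaA : Type := KaehlerDifferential ℂ LaurentTwo

/-- The `ℂ`-submodule `dA ⊆ Ω_A`, the image of the universal derivation `d : A → Ω_A`. -/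
def dAsub : Submodule ℂ OmegaA :=
  LinearMap.range (KaehlerDifferential.D ℂ LaurentTwo).toLinearMap

/-- `K = Ω_A / dA` with canonical projection `π : Ω_A → K`. -/
abbrev Kquot : Type := OmegaA ⧸ dAsub

/-- The underlying vector space `g = (sl₂(ℂ) ⊗ A) ⊕ K` of the 2-toroidal Lie
algebra `sl₂^tor`. -/
abbrev gtor : Type := (sl2C ⊗[ℂ] LaurentTwo) × Kquot

section CurrentAlgebraExtension

variable {R L A M : Type*} [CommRing R] [LieRing L] [LieAlgebra R L] [CommRing A] [Algebra R A]
  [AddCommGroup M] [Module R M]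

/-- The bilinear bracket `[x ⊗ a, y ⊗ b] = [x, y] ⊗ ab` on `L ⊗ A`. -/
def currentBracket (R L A : Type*) [CommRing R] [LieRing L] [LieAlgebra R L] [CommRing A]
    [Algebra R A] : (L ⊗[R] A) →ₗ[R] (L ⊗[R] A) →ₗ[R] (L ⊗[R] A) :=
  TensorProduct.map₂ (LieModule.toEnd R L L : L →ₗ[R] L →ₗ[R] L) (LinearMap.mul R A)

@[simp]
lemma currentBracket_tmul (x y : L) (a b : A) :
    currentBracket R L A (x ⊗ₜ a) (y ⊗ₜ b) = ⁅x, y⁆ ⊗ₜ (a * b) := by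
  simp [currentBracket]

/-- The bilinear map `(x ⊗ a, y ⊗ b) ↦ κ(x, y) • φ(a, b)` on `L ⊗ A`. -/
def currentCocycle (κ : LinearMap.BilinForm R L) (φ : A →ₗ[R] A →ₗ[R] M) :
    (L ⊗[R] A) →ₗ[R] (L ⊗[R] A) →ₗ[R] M :=
  (TensorProduct.map₂ κ φ).compr₂ (TensorProduct.lid R M).toLinearMap

@[simp]
lemma currentCocycle_tmul (κ : LinearMap.BilinForm R L) (φ : A →ₗ[R] A →ₗ[R] M)
    (x y : L) (a b : A) :
    currentCocycle κ φ (x ⊗ₜ a) (y ⊗ₜ b) = κ x y • φ a b := by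
  simp [currentCocycle]

/-- A bilinear map out of `L ⊗ A` that vanishes on the diagonal of pure tensors and is
skew-symmetric on pure tensors is alternating. -/
lemma TensorProduct.isAlt_of_tmul (B : (L ⊗[R] A) →ₗ[R] (L ⊗[R] A) →ₗ[R] M)
    (hself : ∀ x a, B (x ⊗ₜ a) (x ⊗ₜ a) = 0)
    (hskew : ∀ x a y b, B (x ⊗ₜ a) (y ⊗ₜ b) + B (y ⊗ₜ b) (x ⊗ₜ a) = 0) : B.IsAlt := by
  have skew_tmul : ∀ (x : L) (a : A) (v : L ⊗[R] A), B (x ⊗ₜ a) v + B v (x ⊗ₜ a) = 0 := by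
    intro x a v
    induction v with
    | zero => simp
    | tmul y b => exact hskew x a y b
    | add v w hv hw =>
      simp only [map_add, LinearMap.add_apply]
      rw [add_add_add_comm, hv, hw, add_zero]
  have skew : ∀ u v : L ⊗[R] A, B u v + B v u = 0 := by
    intro u v
    induction u with
    | zero => simp
    | tmul x a => exact skew_tmul x a v
    | add u w hu hw =>
      simp only [map_add, LinearMap.add_apply]
      rw [add_add_add_comm, hu, hw, add_zero]
  intro u
  induction u with
  | zero => simp
  | tmul x a => exact hself x a
  | add u v hu hv =>
    have h := skew u v
    simp only [map_add, LinearMap.add_apply, hu, hv, zero_add, add_zero]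
    rwa [add_comm]

/-- The cyclic sum `F(u ∗ v, w) + F(v ∗ w, u) + F(w ∗ u, v)` vanishes as soon as it vanishes on
pure tensors. -/
lemma TensorProduct.cyclic_sum_eq_zero_of_tmul
    (b : (L ⊗[R] A) →ₗ[R] (L ⊗[R] A) →ₗ[R] (L ⊗[R] A))
    (F : (L ⊗[R] A) →ₗ[R] (L ⊗[R] A) →ₗ[R] M)
    (h : ∀ x a y c z d, F (b (x ⊗ₜ a) (y ⊗ₜ c)) (z ⊗ₜ d) + F (b (y ⊗ₜ c) (z ⊗ₜ d)) (x ⊗ₜ a) +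
      F (b (z ⊗ₜ d) (x ⊗ₜ a)) (y ⊗ₜ c) = 0) (u v w : L ⊗[R] A) :
    F (b u v) w + F (b v w) u + F (b w u) v = 0 := by
  have add_aux : ∀ p q r p' q' r' : M, p + q + r = 0 → p' + q' + r' = 0 →
      (p + p') + (q + q') + (r + r') = 0 := by
    intro p q r p' q' r' h₁ h₂
    rw [add_add_add_comm p, add_add_add_comm (p + q), h₁, h₂, add_zero]
  induction u with
  | zero => simp
  | add u u' hu hu' =>
    simp only [map_add, LinearMap.add_apply]
    exact add_aux _ _ _ _ _ _ hu hu'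
  | tmul x a =>
    induction v with
    | zero => simp
    | add v v' hv hv' =>
      simp only [map_add, LinearMap.add_apply]
      exact add_aux _ _ _ _ _ _ hv hv'
    | tmul y c =>
      induction w with
      | zero => simp
      | add w w' hw hw' =>
        simp only [map_add, LinearMap.add_apply]
        exact add_aux _ _ _ _ _ _ hw hw'
      | tmul z d => exact h x a y c z d

lemma currentBracket_isAlt : (currentBracket R L A).IsAlt := by
  refine TensorProduct.isAlt_of_tmul _ (fun x a => by simp) fun x a y b => ?_
  rw [currentBracket_tmul, currentBracket_tmul, mul_comm b a, ← TensorProduct.add_tmul,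
    ← lie_skew x y, neg_add_cancel, TensorProduct.zero_tmul]

lemma currentBracket_jacobi (u v w : L ⊗[R] A) :
    currentBracket R L A (currentBracket R L A u v) w +
      currentBracket R L A (currentBracket R L A v w) u +
      currentBracket R L A (currentBracket R L A w u) v = 0 := by
  refine TensorProduct.cyclic_sum_eq_zero_of_tmul _ _ (fun x a y c z d => ?_) u v w
  simp only [currentBracket_tmul]
  rw [show c * d * a = a * c * d by ring, show d * a * c = a * c * d by ring,
    ← TensorProduct.add_tmul, ← TensorProduct.add_tmul]
  have h : ⁅⁅x, y⁆, z⁆ + ⁅⁅y, z⁆, x⁆ + ⁅⁅z, x⁆, y⁆ = 0 := by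
    rw [← neg_eq_zero, neg_add, neg_add, lie_skew, lie_skew, lie_skew, add_rotate]
    exact lie_jacobi x y z
  rw [h, TensorProduct.zero_tmul]

lemma currentCocycle_isAlt {κ : LinearMap.BilinForm R L} (hκ : ∀ x y, κ x y = κ y x)
    {φ : A →ₗ[R] A →ₗ[R] M} (hφ : φ.IsAlt) : (currentCocycle κ φ).IsAlt := by
  refine TensorProduct.isAlt_of_tmul _ (fun x a => by simp [hφ a]) fun x a y b => ?_
  rw [currentCocycle_tmul, currentCocycle_tmul, hκ x y, ← hφ.neg a b, smul_neg]
  exact add_neg_cancel _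

lemma currentCocycle_cyclic {κ : LinearMap.BilinForm R L} (hκ : ∀ x y, κ x y = κ y x)
    (hinv : ∀ x y z, κ ⁅x, y⁆ z = κ x ⁅y, z⁆) {φ : A →ₗ[R] A →ₗ[R] M}
    (hφ : ∀ a b c, φ (a * b) c + φ (b * c) a + φ (c * a) b = 0) (u v w : L ⊗[R] A) :
    currentCocycle κ φ (currentBracket R L A u v) w +
      currentCocycle κ φ (currentBracket R L A v w) u +
      currentCocycle κ φ (currentBracket R L A w u) v = 0 := by
  refine TensorProduct.cyclic_sum_eq_zero_of_tmul _ _ (fun x a y c z d => ?_) u v w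
  have h₁ : κ ⁅y, z⁆ x = κ ⁅x, y⁆ z := by rw [hinv x y z]; exact hκ _ _
  have h₂ : κ ⁅z, x⁆ y = κ ⁅x, y⁆ z := by rw [hinv z x y]; exact hκ _ _
  simp only [currentBracket_tmul, currentCocycle_tmul]
  rw [h₁, h₂, ← smul_add, ← smul_add, hφ, smul_zero]

end CurrentAlgebraExtension

/-- The bilinear map `(a, b) ↦ π((da) b)` from `A × A` to `K = Ω_A / dA`. -/
def kaehlerPairing : LaurentTwo →ₗ[ℂ] LaurentTwo →ₗ[ℂ] Kquot :=
  (((Algebra.lsmul ℂ ℂ OmegaA : LaurentTwo →ₐ[ℂ] _).toLinearMap).flip.comp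
      (KaehlerDifferential.D ℂ LaurentTwo).toLinearMap).compr₂ dAsub.mkQ

lemma kaehlerPairing_apply (a b : LaurentTwo) :
    kaehlerPairing a b = dAsub.mkQ (b • KaehlerDifferential.D ℂ LaurentTwo a) := rfl

lemma mkQ_D (a : LaurentTwo) : dAsub.mkQ (KaehlerDifferential.D ℂ LaurentTwo a) = 0 :=
  (Submodule.Quotient.mk_eq_zero _).2 ⟨a, rfl⟩

lemma kaehlerPairing_isAlt : kaehlerPairing.IsAlt := by
  intro a
  have h := mkQ_D (a * a)
  rw [Derivation.leibniz, map_add, ← two_smul ℂ] at h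
  exact (smul_eq_zero.1 h).resolve_left two_ne_zero

lemma kaehlerPairing_cyclic (a b c : LaurentTwo) :
    kaehlerPairing (a * b) c + kaehlerPairing (b * c) a + kaehlerPairing (c * a) b = 0 := by
  have h := mkQ_D (a * b * c)
  simp only [kaehlerPairing_apply]
  rw [← map_add, ← map_add]
  have key : c • KaehlerDifferential.D ℂ LaurentTwo (a * b) +
      a • KaehlerDifferential.D ℂ LaurentTwo (b * c) +
      b • KaehlerDifferential.D ℂ LaurentTwo (c * a) =
      KaehlerDifferential.D ℂ LaurentTwo (a * b * c) +
        KaehlerDifferential.D ℂ LaurentTwo (a * b * c) := by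
    simp only [Derivation.leibniz]
    module
  rw [key, map_add, h, add_zero]

/-- the bracket `[x⊗a, y⊗b] = [x,y] ⊗ ab + κ(x,y)·π((da)b)`, together with
`[g, K] = [K, g] = 0`, extends to a well-defined `ℂ`-bilinear map on
`g = (sl₂(ℂ) ⊗ A) ⊕ K` that is alternating and satisfies the Jacobi identity; hence it
makes `g` into a complex Lie algebra (the 2-toroidal Lie algebra `sl₂^tor`) in which `K`
is central. -/
theorem toroidal_sl2_bracket_wellDefined :
    ∃ B : gtor →ₗ[ℂ] gtor →ₗ[ℂ] gtor,
      (∀ (x y : sl2C) (a b : LaurentTwo),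
        B (x ⊗ₜ[ℂ] a, 0) (y ⊗ₜ[ℂ] b, 0) =
          (⁅x, y⁆ ⊗ₜ[ℂ] (a * b),
            killingForm ℂ sl2C x y •
              dAsub.mkQ (b • (KaehlerDifferential.D ℂ LaurentTwo a)))) ∧
      (∀ (ξ : gtor) (c : Kquot), B ξ (0, c) = 0 ∧ B (0, c) ξ = 0) ∧
      (∀ ξ : gtor, B ξ ξ = 0) ∧
      (∀ ξ η ζ : gtor, B (B ξ η) ζ + B (B η ζ) ξ + B (B ζ ξ) η = 0) := by
  let f := currentBracket ℂ sl2C LaurentTwo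
  let g := currentCocycle (killingForm ℂ sl2C) kaehlerPairing
  have hκ := LieModule.traceForm_comm ℂ sl2C sl2C
  let fst := LinearMap.fst ℂ (sl2C ⊗[ℂ] LaurentTwo) Kquot
  let B : gtor →ₗ[ℂ] gtor →ₗ[ℂ] gtor :=
    (f.compl₁₂ fst fst).compr₂ (LinearMap.inl ℂ _ _) +
      (g.compl₁₂ fst fst).compr₂ (LinearMap.inr ℂ _ _)
  have hB : ∀ ξ η : gtor, B ξ η = (f ξ.1 η.1, g ξ.1 η.1) := by
    intro ξ η
    simp [B, fst]
  refine ⟨B, fun x y a b => ?_, fun ξ c => ⟨?_, ?_⟩, fun ξ => ?_, fun ξ η ζ => ?_⟩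
  · simp only [hB, f, g, currentBracket_tmul, currentCocycle_tmul, kaehlerPairing_apply]
  · simp [hB]
  · simp [hB]
  · rw [hB]
    exact Prod.ext (currentBracket_isAlt ξ.1) (currentCocycle_isAlt hκ kaehlerPairing_isAlt ξ.1)
  · simp only [hB]
    exact Prod.ext (currentBracket_jacobi ξ.1 η.1 ζ.1)
      (currentCocycle_cyclic hκ (LieModule.traceForm_apply_lie_apply ℂ sl2C sl2C)
        kaehlerPairing_cyclic ξ.1 η.1 ζ.1)
end
end
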